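/- arXiv:0705.0765 — 3 statements merged into one kernel-verified Lean document; each statement's English description precedes it below -/
import Mathlib

section
/- Casimir functionals are preserved (Proposition 2): Let K ⊂ ℝ² be compact, let f : ℝ × ℝ² → ℝ be smooth with supp f(t,·) ⊆ K for every time t, let g : ℝ × ℝ² → ℝ be smooth, and suppose ∂f/∂t(t,x) = [f(t,·), g(t,·)](x) for all (t,x) ∈ ℝ × ℝ². Then for every C¹ function Φ : ℝ → ℝ with Φ(0) = 0, the function t ↦ ∫_{ℝ²} Φ(f(t,x)) dx is constant. (In particular every Casimir C_Φ = ∫ Φ(f) dq dp is conserved by the dissipative Vlasov equation ∂f/∂t + [f, δH/δf] = [f, [μ(f), δE/δf]], whose right-hand sides combine into a single bracket [f, g] with g = δH/δf − [μ(f), δE/δf], for any energy functional E.) -/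
/-- Partial derivative with respect to the first coordinate `q` on phase space `ℝ × ℝ`. -/
noncomputable def pdq (f : ℝ × ℝ → ℝ) (x : ℝ × ℝ) : ℝ :=
  deriv (fun q => f (q, x.2)) x.1

/-- Partial derivative with respect to the second coordinate `p` on phase space `ℝ × ℝ`. -/
noncomputable def pdp (f : ℝ × ℝ → ℝ) (x : ℝ × ℝ) : ℝ :=
  deriv (fun p => f (x.1, p)) x.2

/-- Canonical Poisson bracket `[f,g] = ∂f/∂q·∂g/∂p − ∂f/∂p·∂g/∂q` on `ℝ × ℝ`. -/
noncomputable def pb (f g : ℝ × ℝ → ℝ) (x : ℝ × ℝ) : ℝ :=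
  pdq f x * pdp g x - pdp f x * pdq g x
theorem pdq_eq_fderiv {f : ℝ × ℝ → ℝ} {x : ℝ × ℝ} (hf : DifferentiableAt ℝ f x) :
    pdq f x = fderiv ℝ f x (1, 0) :=
  (hf.hasFDerivAt.comp_hasDerivAt x.1
    ((hasDerivAt_id x.1).prodMk (hasDerivAt_const x.1 x.2))).deriv

theorem pdp_eq_fderiv {f : ℝ × ℝ → ℝ} {x : ℝ × ℝ} (hf : DifferentiableAt ℝ f x) :
    pdp f x = fderiv ℝ f x (0, 1) :=
  (hf.hasFDerivAt.comp_hasDerivAt x.2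
    ((hasDerivAt_const x.2 x.1).prodMk (hasDerivAt_id x.2))).deriv

theorem pb_comp_left {φ : ℝ → ℝ} {f : ℝ × ℝ → ℝ} {x : ℝ × ℝ} (g : ℝ × ℝ → ℝ)
    (hφ : DifferentiableAt ℝ φ (f x)) (hf : DifferentiableAt ℝ f x) :
    pb (fun y => φ (f y)) g x = deriv φ (f x) * pb f g x := by
  have h : fderiv ℝ (fun y => φ (f y)) x = deriv φ (f x) • fderiv ℝ f x :=
    (hφ.hasDerivAt.comp_hasFDerivAt x hf.hasFDerivAt).fderiv
  have hd : DifferentiableAt ℝ (fun y => φ (f y)) x := hφ.comp x hf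
  simp only [pb, pdq_eq_fderiv hd, pdp_eq_fderiv hd, pdq_eq_fderiv hf, pdp_eq_fderiv hf, h,
    smul_apply, smul_eq_mul]
  ring

/-- Integration by parts on a finite-dimensional space, one factor having compact support. -/
theorem integral_fderiv_mul_fderiv {E : Type*} [NormedAddCommGroup E] [NormedSpace ℝ E]
    [FiniteDimensional ℝ E] [MeasurableSpace E] [BorelSpace E] (μ : MeasureTheory.Measure E)
    [μ.IsAddHaarMeasure] {u h : E → ℝ} (hu : ContDiff ℝ 1 u) (hc : HasCompactSupport u)
    (hh : ContDiff ℝ 2 h) (v w : E) :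
    MeasureTheory.Integrable (fun x => fderiv ℝ u x v * fderiv ℝ h x w) μ ∧
    ∫ x, fderiv ℝ u x v * fderiv ℝ h x w ∂μ =
      -∫ x, u x * fderiv ℝ (fderiv ℝ h) x v w ∂μ := by
  have hdh : ContDiff ℝ 1 (fun x => fderiv ℝ h x w) :=
    (hh.fderiv_right (by norm_num)).clm_apply contDiff_const
  have hdu : Continuous (fun x => fderiv ℝ u x v) :=
    (hu.continuous_fderiv one_ne_zero).clm_apply continuous_const
  have hcu : HasCompactSupport (fun x => fderiv ℝ u x v) := hc.fderiv_apply ℝ v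
  have hddh : Continuous (fun x => fderiv ℝ (fun y => fderiv ℝ h y w) x v) :=
    (hdh.continuous_fderiv one_ne_zero).clm_apply continuous_const
  have h₁ : MeasureTheory.Integrable (fun x => fderiv ℝ u x v * fderiv ℝ h x w) μ :=
    (hdu.mul hdh.continuous).integrable_of_hasCompactSupport hcu.mul_right
  refine ⟨h₁, ?_⟩
  have key := integral_mul_fderiv_eq_neg_fderiv_mul_of_integrable (μ := μ) (v := v) h₁
    ((hu.continuous.mul hddh).integrable_of_hasCompactSupport hc.mul_right)
    ((hu.continuous.mul hdh.continuous).integrable_of_hasCompactSupport hc.mul_right)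
    (fun x _ => hu.differentiable one_ne_zero x) (fun x _ => hdh.differentiable one_ne_zero x)
  have hd (x : E) : fderiv ℝ (fun y => fderiv ℝ h y w) x v = fderiv ℝ (fderiv ℝ h) x v w := by
    rw [fderiv_clm_apply ((hh.fderiv_right (m := 1) (by norm_num)).differentiable one_ne_zero x)
      (differentiableAt_const w)]
    simp
  simp only [hd] at key
  linarith

theorem integral_pb_eq_zero {u h : ℝ × ℝ → ℝ} (hu : ContDiff ℝ 1 u) (hc : HasCompactSupport u)
    (hh : ContDiff ℝ 2 h) : ∫ x, pb u h x = 0 := by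
  have hu' := hu.differentiable one_ne_zero
  have hh' := hh.differentiable two_ne_zero
  obtain ⟨i₁, e₁⟩ :=
    integral_fderiv_mul_fderiv MeasureTheory.volume hu hc hh ((1, 0) : ℝ × ℝ) (0, 1)
  obtain ⟨i₂, e₂⟩ :=
    integral_fderiv_mul_fderiv MeasureTheory.volume hu hc hh ((0, 1) : ℝ × ℝ) (1, 0)
  have hsymm (x : ℝ × ℝ) : fderiv ℝ (fderiv ℝ h) x (1, 0) (0, 1) =
      fderiv ℝ (fderiv ℝ h) x (0, 1) (1, 0) :=
    (hh.contDiffAt.isSymmSndFDerivAt (by simp)) _ _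
  simp only [pb, pdq_eq_fderiv (hu' _), pdp_eq_fderiv (hu' _), pdq_eq_fderiv (hh' _),
    pdp_eq_fderiv (hh' _)]
  rw [MeasureTheory.integral_sub i₁ i₂, e₁, e₂]
  simp only [hsymm, sub_self]

/-- Differentiation under the integral sign for a `C¹` family of functions supported in a fixed
compact set. -/
theorem hasDerivAt_integral_of_support_subset {E : Type*} [NormedAddCommGroup E]
    [NormedSpace ℝ E] [MeasurableSpace E] [BorelSpace E] (μ : MeasureTheory.Measure E)
    [MeasureTheory.IsFiniteMeasureOnCompacts μ] {K : Set E} (hK : IsCompact K) {U : ℝ × E → ℝ}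
    (hU : ContDiff ℝ 1 U) (hsupp : ∀ t x, x ∉ K → U (t, x) = 0) (t : ℝ) :
    HasDerivAt (fun s => ∫ x, U (s, x) ∂μ) (∫ x, deriv (fun s => U (s, x)) t ∂μ) t := by
  have hd (s : ℝ) (x : E) : HasDerivAt (fun r => U (r, x)) (fderiv ℝ U (s, x) (1, 0)) s :=
    (hU.differentiable one_ne_zero (s, x)).hasFDerivAt.comp_hasDerivAt s
      ((hasDerivAt_id s).prodMk (hasDerivAt_const s x))
  have hcont : Continuous (fun y => fderiv ℝ U y (1, 0)) :=
    (hU.continuous_fderiv one_ne_zero).clm_apply continuous_const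
  have hzero (s : ℝ) (x : E) (hx : x ∉ K) : fderiv ℝ U (s, x) (1, 0) = 0 := by
    refine (hd s x).unique ?_
    simpa only [hsupp _ x hx] using hasDerivAt_const s (0 : ℝ)
  have hint {V : ℝ × E → ℝ} (hV : Continuous V) (h0 : ∀ s x, x ∉ K → V (s, x) = 0) (s : ℝ) :
      MeasureTheory.Integrable (fun x => V (s, x)) μ :=
    (hV.comp (Continuous.prodMk_right s)).integrable_of_hasCompactSupport
      (HasCompactSupport.intro hK (h0 s))
  obtain ⟨C, hC⟩ := ((isCompact_closedBall t 1).prod hK).exists_bound_of_continuousOn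
    hcont.continuousOn
  have hb : MeasureTheory.Integrable (K.indicator fun _ => C) μ :=
    (MeasureTheory.integrableOn_const hK.measure_lt_top.ne).integrable_indicator hK.measurableSet
  have h := hasDerivAt_integral_of_dominated_loc_of_deriv_le
    (F := fun s x => U (s, x)) (F' := fun s x => fderiv ℝ U (s, x) (1, 0))
    (Metric.ball_mem_nhds t one_pos)
    (.of_forall fun s => (hint hU.continuous hsupp s).aestronglyMeasurable)
    (hint hU.continuous hsupp t) (hint hcont hzero t).aestronglyMeasurable
    (.of_forall fun x s hs => ?_) hb (.of_forall fun x s _ => hd s x)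
  · simpa only [(hd t _).deriv] using h.2
  · by_cases hx : x ∈ K
    · simpa only [Set.indicator_of_mem hx] using
        hC (s, x) ⟨Metric.ball_subset_closedBall hs, hx⟩
    · simp [hx, hzero s x hx]

/-- Casimir functionals `C_Φ = ∫ Φ(f)` are preserved under any evolution
`∂f/∂t = [f, g]`, for `f` smooth with support uniformly contained in a compact set `K`. -/
theorem casimir_preserved (K : Set (ℝ × ℝ)) (hK : IsCompact K)
    (f g : ℝ × (ℝ × ℝ) → ℝ)
    (hf : ContDiff ℝ (⊤ : ℕ∞) f) (hg : ContDiff ℝ (⊤ : ℕ∞) g)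
    (hsupp : ∀ t : ℝ, Function.support (fun x => f (t, x)) ⊆ K)
    (heq : ∀ (t : ℝ) (x : ℝ × ℝ),
      deriv (fun s => f (s, x)) t = pb (fun y => f (t, y)) (fun y => g (t, y)) x)
    (Φ : ℝ → ℝ) (hΦ : ContDiff ℝ 1 Φ) (hΦ0 : Φ 0 = 0) :
    ∀ t₁ t₂ : ℝ,
      ∫ x : ℝ × ℝ, Φ (f (t₁, x)) = ∫ x : ℝ × ℝ, Φ (f (t₂, x)) := by
  have hsl {F : ℝ × (ℝ × ℝ) → ℝ} {n : ℕ∞} (hF : ContDiff ℝ n F) (t : ℝ) :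
      ContDiff ℝ n (fun x => F (t, x)) := hF.comp (contDiff_const.prodMk contDiff_id)
  have hΦd := hΦ.differentiable one_ne_zero
  have hU : ContDiff ℝ 1 (fun y => Φ (f y)) := hΦ.comp (hf.of_le (by exact_mod_cast le_top))
  have h0 (t : ℝ) (x : ℝ × ℝ) (hx : x ∉ K) : Φ (f (t, x)) = 0 := by
    rw [Function.notMem_support.mp fun h => hx (hsupp t h), hΦ0]
  have hder (t : ℝ) (x : ℝ × ℝ) : deriv (fun s => Φ (f (s, x))) t =
      pb (fun y => Φ (f (t, y))) (fun y => g (t, y)) x := by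
    have hft : DifferentiableAt ℝ (fun s => f (s, x)) t :=
      (hf.differentiable (by simp) (t, x)).comp t
        (differentiableAt_id.prodMk (differentiableAt_const x))
    rw [pb_comp_left _ (hΦd _) ((hsl hf t).differentiable (by simp) x), ← heq]
    exact ((hΦd _).hasDerivAt.comp t hft.hasDerivAt).deriv
  have hI (t : ℝ) : HasDerivAt (fun s => ∫ x : ℝ × ℝ, Φ (f (s, x))) 0 t := by
    have h := hasDerivAt_integral_of_support_subset MeasureTheory.volume hK hU h0 t
    simp only [hder] at h
    rwa [integral_pb_eq_zero (hsl (n := 1) hU t) (HasCompactSupport.intro hK (h0 t))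
      (contDiff_infty.1 (hsl hg t) 2)] at h
  exact is_const_of_deriv_eq_zero (fun t => (hI t).differentiableAt) fun t => (hI t).deriv
end

section
/- Single-particle solutions (Theorem 1, converse direction, one particle): Let ℋ : ℝ × ℝ² → ℝ be smooth and let Q, P : ℝ → ℝ be differentiable. Suppose that for every smooth compactly supported φ : ℝ² → ℝ and every t ∈ ℝ, the function s ↦ φ(Q(s), P(s)) has derivative [φ, ℋ(t,·)](Q(t), P(t)) at s = t. Then Q and P satisfy the canonical Hamilton equations: Q'(t) = ∂ℋ/∂p(t, Q(t), P(t)) and P'(t) = −∂ℋ/∂q(t, Q(t), P(t)) for all t. (Hence the single-particle delta-function ansatz solves the equation ∂f/∂t = −[f, ℋ] weakly exactly when the particle follows canonical dynamics with Hamiltonian ℋ.) -/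
/-- Near any point, a smooth function agrees with a smooth compactly supported one. -/
lemma exists_contDiff_hasCompactSupport_eventuallyEq {g : ℝ × ℝ → ℝ}
    (hg : ContDiff ℝ (⊤ : ℕ∞) g) (x : ℝ × ℝ) :
    ∃ φ : ℝ × ℝ → ℝ, ContDiff ℝ (⊤ : ℕ∞) φ ∧ HasCompactSupport φ ∧ φ =ᶠ[nhds x] g := by
  let b : ContDiffBump x := default
  refine ⟨fun y => b y * g y, b.contDiff.mul hg, b.hasCompactSupport.mul_right, ?_⟩
  filter_upwards [b.eventuallyEq_one] with y hy
  simp [hy]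

lemma Filter.EventuallyEq.pdq_eq {f g : ℝ × ℝ → ℝ} {x : ℝ × ℝ} (h : f =ᶠ[nhds x] g) :
    pdq f x = pdq g x := by
  have hc : Continuous fun q : ℝ => (q, x.2) := by fun_prop
  exact Filter.EventuallyEq.deriv_eq (hc.tendsto x.1 |>.eventually h)

lemma Filter.EventuallyEq.pdp_eq {f g : ℝ × ℝ → ℝ} {x : ℝ × ℝ} (h : f =ᶠ[nhds x] g) :
    pdp f x = pdp g x := by
  have hc : Continuous fun p : ℝ => (x.1, p) := by fun_prop
  exact Filter.EventuallyEq.deriv_eq (hc.tendsto x.2 |>.eventually h)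

lemma Filter.EventuallyEq.pb_eq {f g h : ℝ × ℝ → ℝ} {x : ℝ × ℝ} (hfg : f =ᶠ[nhds x] g) :
    pb f h x = pb g h x := by
  simp only [pb, hfg.pdq_eq, hfg.pdp_eq]

lemma pb_fst (h : ℝ × ℝ → ℝ) (x : ℝ × ℝ) : pb Prod.fst h x = pdp h x := by
  simp [pb, pdq, pdp]

lemma pb_snd (h : ℝ × ℝ → ℝ) (x : ℝ × ℝ) : pb Prod.snd h x = -pdq h x := by
  simp [pb, pdq, pdp]

/-- The weak equation along a continuous curve, tested against compactly supported functions,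
extends to all smooth observables. -/
lemma hasDerivAt_of_weak {h : ℝ × ℝ → ℝ} {γ : ℝ → ℝ × ℝ} {t : ℝ} (hγ : ContinuousAt γ t)
    (hweak : ∀ φ : ℝ × ℝ → ℝ, ContDiff ℝ (⊤ : ℕ∞) φ → HasCompactSupport φ →
      HasDerivAt (fun s => φ (γ s)) (pb φ h (γ t)) t)
    {g : ℝ × ℝ → ℝ} (hg : ContDiff ℝ (⊤ : ℕ∞) g) :
    HasDerivAt (fun s => g (γ s)) (pb g h (γ t)) t := by
  obtain ⟨φ, hφ, hφc, hφg⟩ := exists_contDiff_hasCompactSupport_eventuallyEq hg (γ t)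
  rw [← hφg.pb_eq]
  exact (hweak φ hφ hφc).congr_of_eventuallyEq (hγ.eventually hφg.symm)

/-- Single-particle solutions, converse direction (one particle): if the single-particle
delta ansatz solves `∂f/∂t = −[f, ℋ]` weakly against all smooth compactly supported test
functions, then the particle obeys the canonical Hamilton equations. -/
theorem single_particle_converse (H : ℝ × (ℝ × ℝ) → ℝ) (hH : ContDiff ℝ (⊤ : ℕ∞) H)
    (Q P : ℝ → ℝ) (hQd : Differentiable ℝ Q) (hPd : Differentiable ℝ P)
    (hweak : ∀ (φ : ℝ × ℝ → ℝ), ContDiff ℝ (⊤ : ℕ∞) φ → HasCompactSupport φ → ∀ t : ℝ,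
      HasDerivAt (fun s => φ (Q s, P s))
        (pb φ (fun x => H (t, x)) (Q t, P t)) t) :
    ∀ t : ℝ,
      HasDerivAt Q (pdp (fun x => H (t, x)) (Q t, P t)) t ∧
      HasDerivAt P (-(pdq (fun x => H (t, x)) (Q t, P t))) t := by
  intro t
  have hγ : ContinuousAt (fun s => (Q s, P s)) t :=
    (hQd t).continuousAt.prodMk (hPd t).continuousAt
  have hw := fun φ hφ hφc => hweak φ hφ hφc t
  constructor
  · rw [← pb_fst]
    exact hasDerivAt_of_weak hγ hw contDiff_fst
  · rw [← pb_snd]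
    exact hasDerivAt_of_weak hγ hw contDiff_snd
end

section
/- Moment equations from the Vlasov bracket (Kupershmidt–Manin coadjoint action): Let f : ℝ² → ℝ be smooth and compactly supported, let β : ℝ → ℝ be smooth, and let n ≥ 0, m ≥ 1 be integers. Define the moments A_k(q) = ∫_ℝ p^k·f(q,p) dp. Then for every q ∈ ℝ, ∫_ℝ p^n·[f, (q,p) ↦ p^m·β(q)](q,p) dp = m·β(q)·A_{n+m−1}'(q) + (n+m)·β'(q)·A_{n+m−1}(q). (Consequently, under the evolution ∂f/∂t = −[f, p^m β(q)], the moments satisfy the Kupershmidt–Manin equation Ȧ_n = −(n+m)·A_{n+m−1}·∂β/∂q − m·β·∂A_{n+m−1}/∂q, i.e., Ȧ_n = −ad*_{β_m} A_{n+m−1} up to the bracket sign convention.) -/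
/-- Kinetic moments: `A k q = ∫ p^k f(q,p) dp`. -/
noncomputable def kmoment (f : ℝ × ℝ → ℝ) (k : ℕ) (q : ℝ) : ℝ :=
  ∫ p : ℝ, p ^ k * f (q, p)

open MeasureTheory in
theorem integrable_pow_mul_slice {g : ℝ × ℝ → ℝ} (hg : Continuous g) (hgc : HasCompactSupport g)
    (k : ℕ) (q : ℝ) : Integrable (fun p : ℝ => p ^ k * g (q, p)) := by
  have hs : HasCompactSupport (fun p : ℝ => g (q, p)) :=
    hgc.comp_isClosedEmbedding
      (Isometry.of_dist_eq fun x y => by simp [Prod.dist_eq]).isClosedEmbedding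
  exact Continuous.integrable_of_hasCompactSupport (by fun_prop) hs.mul_left

theorem hasDerivAt_slice_fst {f : ℝ × ℝ → ℝ} (hf : Differentiable ℝ f) (q p : ℝ) :
    HasDerivAt (fun q => f (q, p)) (fderiv ℝ f (q, p) (1, 0)) q :=
  (hf (q, p)).hasFDerivAt.comp_hasDerivAt q ((hasDerivAt_id q).prodMk (hasDerivAt_const q p))

theorem hasDerivAt_slice_snd {f : ℝ × ℝ → ℝ} (hf : Differentiable ℝ f) (q p : ℝ) :
    HasDerivAt (fun p => f (q, p)) (fderiv ℝ f (q, p) (0, 1)) p :=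
  (hf (q, p)).hasFDerivAt.comp_hasDerivAt p ((hasDerivAt_const p q).prodMk (hasDerivAt_id p))

open MeasureTheory in
theorem hasDerivAt_kmoment {f : ℝ × ℝ → ℝ} (hf : ContDiff ℝ 1 f) (hfc : HasCompactSupport f)
    (k : ℕ) (q : ℝ) :
    HasDerivAt (kmoment f k) (∫ p : ℝ, p ^ k * fderiv ℝ f (q, p) (1, 0)) q := by
  have hcont : Continuous (fun x => fderiv ℝ f x (1, 0)) :=
    (hf.continuous_fderiv one_ne_zero).clm_apply continuous_const
  have hcs : HasCompactSupport (fun x => fderiv ℝ f x (1, 0)) := hfc.fderiv_apply ℝ (1, 0)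
  have hcs' : HasCompactSupport (fun x : ℝ × ℝ => x.2 ^ k * fderiv ℝ f x (1, 0)) := hcs.mul_left
  obtain ⟨C, hC⟩ := hcs'.exists_bound_of_continuous (by fun_prop)
  set K : Set ℝ := Prod.snd '' tsupport (fun x : ℝ × ℝ => x.2 ^ k * fderiv ℝ f x (1, 0))
  have hK : IsCompact K := hcs'.isCompact.image continuous_snd
  have hfk := integrable_pow_mul_slice hf.continuous hfc k
  refine (hasDerivAt_integral_of_dominated_loc_of_deriv_le (μ := volume)
    (F := fun q p => p ^ k * f (q, p)) (F' := fun q p => p ^ k * fderiv ℝ f (q, p) (1, 0))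
    (bound := K.indicator fun _ => C) Filter.univ_mem
    (.of_forall fun q' => (hfk q').aestronglyMeasurable) (hfk q)
    (integrable_pow_mul_slice hcont hcs k q).aestronglyMeasurable
    (.of_forall fun p q' _ => ?_) ?_ (.of_forall fun p q' _ => ?_)).2
  · by_cases hp : p ∈ K
    · simpa [hp] using hC (q', p)
    · have h0 : p ^ k * fderiv ℝ f (q', p) (1, 0) = 0 :=
        image_eq_zero_of_notMem_tsupport
          (f := fun x : ℝ × ℝ => x.2 ^ k * fderiv ℝ f x (1, 0)) (x := (q', p))
          fun h => hp ⟨_, h, rfl⟩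
      simp [hp, h0]
  · exact (integrable_indicator_iff hK.measurableSet).2
      (integrableOn_const hK.measure_lt_top.ne)
  · exact (hasDerivAt_slice_fst (hf.differentiable one_ne_zero) q' p).const_mul (p ^ k)

open MeasureTheory in
theorem integral_pow_succ_mul_fderiv_snd {f : ℝ × ℝ → ℝ} (hf : ContDiff ℝ 1 f)
    (hfc : HasCompactSupport f) (k : ℕ) (q : ℝ) :
    ∫ p : ℝ, p ^ (k + 1) * fderiv ℝ f (q, p) (0, 1) = -((k + 1) * kmoment f k q) := by
  have hcont : Continuous (fun x => fderiv ℝ f x (0, 1)) :=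
    (hf.continuous_fderiv one_ne_zero).clm_apply continuous_const
  have hcs : HasCompactSupport (fun x => fderiv ℝ f x (0, 1)) := hfc.fderiv_apply ℝ (0, 1)
  have hfk := (integrable_pow_mul_slice hf.continuous hfc k q).const_mul ((k : ℝ) + 1)
  rw [integral_mul_deriv_eq_deriv_mul_of_integrable (u := fun p : ℝ => p ^ (k + 1))
    (u' := fun p : ℝ => (k + 1) * p ^ k) (v := fun p => f (q, p))
    (fun p _ => by simpa using hasDerivAt_pow (k + 1) p)
    (fun p _ => hasDerivAt_slice_snd (hf.differentiable one_ne_zero) q p)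
    (integrable_pow_mul_slice hcont hcs (k + 1) q)
    (hfk.congr (.of_forall fun p => by simp [mul_assoc]))
    (integrable_pow_mul_slice hf.continuous hfc (k + 1) q)]
  simp only [kmoment, mul_assoc, integral_const_mul]

theorem pb_pow_mul {f : ℝ × ℝ → ℝ} {β : ℝ → ℝ} (hf : Differentiable ℝ f) (m : ℕ) (q p : ℝ) :
    pb f (fun x => x.2 ^ m * β x.1) (q, p)
      = fderiv ℝ f (q, p) (1, 0) * (m * p ^ (m - 1) * β q)
        - fderiv ℝ f (q, p) (0, 1) * (p ^ m * deriv β q) := by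
  simp [pb, pdq, pdp, (hasDerivAt_slice_fst hf q p).deriv, (hasDerivAt_slice_snd hf q p).deriv]

/-- Moment equations from the Vlasov bracket: pairing the Poisson bracket
`[f, p^m β(q)]` against `p^n` yields the Kupershmidt–Manin coadjoint action on the
moment `A_{n+m−1}`. -/
theorem moment_equations (f : ℝ × ℝ → ℝ) (β : ℝ → ℝ)
    (hf : ContDiff ℝ (⊤ : ℕ∞) f) (hfc : HasCompactSupport f) (hβ : ContDiff ℝ (⊤ : ℕ∞) β)
    (n m : ℕ) (hm : 1 ≤ m) :
    ∀ q : ℝ,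
      (∫ p : ℝ, p ^ n * pb f (fun x => x.2 ^ m * β x.1) (q, p))
        = (m : ℝ) * β q * deriv (kmoment f (n + m - 1)) q
          + ((n : ℝ) + m) * deriv β q * kmoment f (n + m - 1) q := by
  intro q
  obtain ⟨k, rfl⟩ := Nat.exists_eq_add_of_le' hm
  have hf1 : ContDiff ℝ 1 f := hf.of_le (by exact_mod_cast le_top)
  have hcont (v : ℝ × ℝ) : Continuous (fun x => fderiv ℝ f x v) :=
    (hf1.continuous_fderiv one_ne_zero).clm_apply continuous_const
  have hint (v : ℝ × ℝ) (j : ℕ) :=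
    integrable_pow_mul_slice (hcont v) (hfc.fderiv_apply ℝ v) j q
  have hpb (p : ℝ) : p ^ n * pb f (fun x => x.2 ^ (k + 1) * β x.1) (q, p)
      = ((k + 1 : ℕ) * β q) * (p ^ (n + k) * fderiv ℝ f (q, p) (1, 0))
        - deriv β q * (p ^ (n + k + 1) * fderiv ℝ f (q, p) (0, 1)) := by
    rw [pb_pow_mul (hf1.differentiable one_ne_zero), Nat.add_sub_cancel]
    ring
  simp only [hpb]
  rw [MeasureTheory.integral_sub ((hint _ _).const_mul _) ((hint _ _).const_mul _),
    MeasureTheory.integral_const_mul, MeasureTheory.integral_const_mul,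
    integral_pow_succ_mul_fderiv_snd hf1 hfc, ← add_assoc, Nat.add_sub_cancel,
    (hasDerivAt_kmoment hf1 hfc (n + k) q).deriv]
  push_cast
  ring
end
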